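/- For every n ≥ 1, every nondeterministic Büchi automaton over the alphabet Σ = {0,1,#,&} recognizing the disjoint union L_n ⊎ {0,1,#}^ω has at least 2^{2^n} states. -/

import Mathlib

/-- The length-`n` prefix `w_0 ⋯ w_{n-1}` of an infinite word `w`. -/
def prefixWord {α : Type} (w : ℕ → α) (n : ℕ) : List α :=
  (List.range n).map w

/-- Concatenation of a finite word `u` with an infinite word `v`. -/
def wcat {α : Type} (u : List α) (v : ℕ → α) : ℕ → α :=
  fun i => if h : i < u.length then u.get ⟨i, h⟩ else v (i - u.length)

/-- The four-letter alphabet Σ = {0, 1, #, &}. -/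
inductive Sig4 : Type where
  | zero : Sig4
  | one : Sig4
  | hash : Sig4
  | amp : Sig4
deriving DecidableEq

/-- Encoding of a bit as a letter in {0,1}. -/
def bitSym (b : Bool) : Sig4 := if b then Sig4.one else Sig4.zero

/-- The block `#w#` for a bit-string `w`. -/
def blk (w : List Bool) : List Sig4 :=
  Sig4.hash :: (w.map bitSym ++ [Sig4.hash])

/-- A finite word contains no occurrence of `&`. -/
def NoAmpL (u : List Sig4) : Prop := ∀ a ∈ u, a ≠ Sig4.amp

/-- An infinite word contains no occurrence of `&`. -/
def NoAmpW (v : ℕ → Sig4) : Prop := ∀ i, v i ≠ Sig4.amp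

/-- The finite word `p` occurs as a factor of the infinite word `v`. -/
def OccursInW (p : List Sig4) (v : ℕ → Sig4) : Prop :=
  ∃ i, prefixWord (fun j => v (i + j)) p.length = p

/-- The ω-language `L_n`: words `u · & · v` with `u ∈ {0,1,#}^*`, `v ∈ {0,1,#}^ω`
such that every block `#w#` (with `w ∈ {0,1}^n`) occurring in `v` also occurs in `u`. -/
def Ln (n : ℕ) : Set (ℕ → Sig4) :=
  { x | ∃ (u : List Sig4) (v : ℕ → Sig4), NoAmpL u ∧ NoAmpW v ∧
      x = wcat (u ++ [Sig4.amp]) v ∧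
      ∀ w : List Bool, w.length = n → OccursInW (blk w) v → blk w <:+: u }

/-- The language of finite words `F_n`: words `u · & · v` with `u, v ∈ {0,1,#}^*`
such that if the last `n+2` letters of `v` form a block `#w#` with `w ∈ {0,1}^n`,
then `#w#` occurs in `u`. -/
def Fn (n : ℕ) : Set (List Sig4) :=
  { x | ∃ u v : List Sig4, NoAmpL u ∧ NoAmpL v ∧
      x = u ++ Sig4.amp :: v ∧
      ∀ w : List Bool, w.length = n → blk w <:+ v → blk w <:+: u }

/-- A nondeterministic Büchi automaton over alphabet `A` with state type `S`. -/
structure NBA (A : Type) (S : Type) where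
  init : S
  trans : S → A → S → Prop
  acc : Set S

/-- `r` is a run of `M` on the infinite word `w`. -/
def NBA.IsRun {A S : Type} (M : NBA A S) (w : ℕ → A) (r : ℕ → S) : Prop :=
  r 0 = M.init ∧ ∀ i, M.trans (r i) (w i) (r (i + 1))

/-- The ω-language of a nondeterministic Büchi automaton: words admitting a run
that visits the accepting set infinitely often. -/
def NBA.Lang {A S : Type} (M : NBA A S) : Set (ℕ → A) :=
  { w | ∃ r : ℕ → S, M.IsRun w r ∧ ∀ m : ℕ, ∃ n, m ≤ n ∧ r n ∈ M.acc }

theorem wcat_of_lt {α : Type} {u : List α} {v : ℕ → α} {i : ℕ} (h : i < u.length) :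
    wcat u v i = u[i] := by
  simp [wcat, h]

theorem wcat_add {α : Type} (u : List α) (v : ℕ → α) (i : ℕ) :
    wcat u v (u.length + i) = v i := by
  simp [wcat]

theorem prefixWord_wcat_append {α : Type} (u : List α) (v : ℕ → α) (k : ℕ) :
    prefixWord (wcat u v) (u.length + k) = u ++ prefixWord v k := by
  apply List.ext_getElem
  · simp [prefixWord]
  · intro i h₁ h₂
    by_cases hi : i < u.length
    · simp [prefixWord, wcat_of_lt hi, List.getElem_append_left hi]
    · obtain ⟨j, rfl⟩ := Nat.exists_eq_add_of_le (not_lt.mp hi)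
      simp [prefixWord, wcat_add]

theorem prefixWord_add {α : Type} (v : ℕ → α) (i k : ℕ) :
    prefixWord v (i + k) = prefixWord v i ++ prefixWord (fun j => v (i + j)) k := by
  simp [prefixWord, List.range_add, Function.comp_def]

/-- A finite word occurring in `u · v` is a factor of `u` followed by a finite prefix of `v`. -/
theorem OccursInW.exists_isInfix {p u : List Sig4} {v : ℕ → Sig4} (h : OccursInW p (wcat u v)) :
    ∃ k, p <:+: u ++ prefixWord v k := by
  obtain ⟨i, hi⟩ := h
  refine ⟨i + p.length, prefixWord (wcat u v) i,
    prefixWord (fun j => wcat u v (i + p.length + j)) u.length, ?_⟩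
  rw [← prefixWord_wcat_append u, add_comm u.length, prefixWord_add, prefixWord_add, hi]

theorem occursInW_wcat_of_isInfix {p u : List Sig4} (v : ℕ → Sig4) (h : p <:+: u) :
    OccursInW p (wcat u v) := by
  obtain ⟨s, t, rfl⟩ := h
  refine ⟨s.length, ?_⟩
  apply List.ext_getElem
  · simp [prefixWord]
  · intro i h₁ h₂
    have hlt : s.length + i < (s ++ p ++ t).length := by simp; omega
    simp only [prefixWord, List.getElem_map, List.getElem_range]
    rw [wcat_of_lt hlt]
    simp [h₂]

theorem bitSym_ne_hash (b : Bool) : bitSym b ≠ Sig4.hash := by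
  cases b <;> simp [bitSym]

theorem bitSym_ne_amp (b : Bool) : bitSym b ≠ Sig4.amp := by
  cases b <;> simp [bitSym]

theorem bitSym_injective : Function.Injective bitSym := by
  intro a b; cases a <;> cases b <;> simp [bitSym]

theorem noAmpL_flatMap_blk (l : List (List Bool)) : NoAmpL (l.flatMap blk) := by
  intro a ha
  simp only [List.mem_flatMap, blk, List.mem_cons, List.mem_append, List.mem_map] at ha
  obtain ⟨w, -, rfl | ⟨b, -, rfl⟩ | rfl | h⟩ := ha
  · simp
  · exact bitSym_ne_amp b
  · simp
  · simp at h

/-- Two bit-strings terminated by `#` at the start of a common word are equal. -/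
theorem eq_of_map_bitSym_hash_isPrefix {w a : List Bool} {T : List Sig4}
    (h : w.map bitSym ++ [Sig4.hash] <+: a.map bitSym ++ Sig4.hash :: T) : w = a := by
  induction w generalizing a with
  | nil =>
    cases a with
    | nil => rfl
    | cons b a =>
      simp [List.cons_prefix_cons] at h
      exact absurd h.symm (bitSym_ne_hash b)
  | cons c w ih =>
    cases a with
    | nil =>
      simp [List.cons_prefix_cons] at h
      exact absurd h.1 (bitSym_ne_hash c)
    | cons b a =>
      simp only [List.map_cons, List.cons_append, List.cons_prefix_cons] at h
      rw [bitSym_injective h.1, ih h.2]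

theorem blk_isInfix_of_map_bitSym_append {w a : List Bool} {T : List Sig4}
    (h : blk w <:+: a.map bitSym ++ T) : blk w <:+: T := by
  induction a with
  | nil => simpa using h
  | cons b a ih =>
    simp only [List.map_cons, List.cons_append, List.infix_cons_iff] at h
    rcases h with h | h
    · simp only [blk, List.cons_prefix_cons] at h
      exact absurd h.1.symm (bitSym_ne_hash b)
    · exact ih h

theorem blk_isInfix_of_hash_cons {w : List Bool} (hw : w ≠ []) {T : List Sig4}
    (hT : ∀ c ∈ T.head?, c = Sig4.hash) (h : blk w <:+: Sig4.hash :: T) : blk w <:+: T := by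
  rcases List.infix_cons_iff.mp h with h | h
  · cases w with
    | nil => exact absurd rfl hw
    | cons b w =>
      cases T with
      | nil => simp [blk, List.cons_prefix_cons] at h
      | cons c T =>
        simp [blk, List.cons_prefix_cons] at h
        exact absurd (h.1.trans (hT c (by simp))) (bitSym_ne_hash b)
  · exact h

/-- In a concatenation of blocks padded by `#`, the only nonempty blocks are the obvious ones. -/
theorem mem_of_blk_isInfix {w : List Bool} (hw : w ≠ []) {l : List (List Bool)} {k : ℕ}
    (h : blk w <:+: l.flatMap blk ++ List.replicate k Sig4.hash) : w ∈ l := by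
  induction l with
  | nil =>
    exfalso
    cases w with
    | nil => exact hw rfl
    | cons b w =>
      have : bitSym b ∈ List.replicate k Sig4.hash := h.subset (by simp [blk])
      exact bitSym_ne_hash b (List.eq_of_mem_replicate this)
  | cons a l ih =>
    set T := l.flatMap blk ++ List.replicate k Sig4.hash with hTdef
    have hT : ∀ c ∈ T.head?, c = Sig4.hash := by
      intro c hc
      rw [hTdef] at hc
      cases l with
      | nil => cases k <;> simp_all [List.replicate_succ]
      | cons => simpa [blk, eq_comm] using hc
    have h' : blk w <:+: Sig4.hash :: (a.map bitSym ++ Sig4.hash :: T) := by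
      simpa [blk, hTdef] using h
    rcases List.infix_cons_iff.mp h' with h' | h'
    · simp only [blk, List.cons_prefix_cons] at h'
      simp [eq_of_map_bitSym_hash_isPrefix h'.2]
    · exact List.mem_cons_of_mem _
        (ih (blk_isInfix_of_hash_cons hw hT (blk_isInfix_of_map_bitSym_append h')))

theorem prefixWord_const {α : Type} (a : α) (k : ℕ) :
    prefixWord (fun _ => a) k = List.replicate k a := by
  simp [prefixWord]

theorem mem_of_occursInW {w : List Bool} (hw : w ≠ []) {l : List (List Bool)}
    (h : OccursInW (blk w) (wcat (l.flatMap blk) fun _ => Sig4.hash)) : w ∈ l := by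
  obtain ⟨k, hk⟩ := h.exists_isInfix
  rw [prefixWord_const] at hk
  exact mem_of_blk_isInfix hw hk

theorem blk_isInfix_flatMap {w : List Bool} {l : List (List Bool)} (h : w ∈ l) :
    blk w <:+: l.flatMap blk :=
  List.infix_of_mem_flatten (List.mem_map_of_mem h)

theorem NoAmpL.noAmpW_wcat {u : List Sig4} {v : ℕ → Sig4} (hu : NoAmpL u) (hv : NoAmpW v) :
    NoAmpW (wcat u v) := by
  intro i
  by_cases h : i < u.length
  · rw [wcat_of_lt h]
    exact hu _ (List.getElem_mem h)
  · obtain ⟨j, rfl⟩ := Nat.exists_eq_add_of_le (not_lt.mp h)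
    rw [wcat_add]
    exact hv j

theorem wcat_append_singleton_length {α : Type} (u : List α) (a : α) (v : ℕ → α) :
    wcat (u ++ [a]) v u.length = a := by
  rw [wcat_of_lt (by simp)]
  simp

theorem length_le_of_wcat_amp_eq {u u' : List Sig4} {v v' : ℕ → Sig4} (hu' : NoAmpL u')
    (h : wcat (u ++ [Sig4.amp]) v = wcat (u' ++ [Sig4.amp]) v') : u'.length ≤ u.length := by
  by_contra! hlt
  have h₁ := congrFun h u.length
  rw [wcat_append_singleton_length, wcat_of_lt (by simp; omega),
    List.getElem_append_left hlt] at h₁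
  exact hu' _ (List.getElem_mem hlt) h₁.symm

/-- The decomposition of a word around its only `&` is unique. -/
theorem wcat_amp_inj {u u' : List Sig4} {v v' : ℕ → Sig4} (hu : NoAmpL u) (hu' : NoAmpL u')
    (h : wcat (u ++ [Sig4.amp]) v = wcat (u' ++ [Sig4.amp]) v') : u = u' ∧ v = v' := by
  have hlen : u.length = u'.length :=
    le_antisymm (length_le_of_wcat_amp_eq hu h.symm) (length_le_of_wcat_amp_eq hu' h)
  constructor
  · apply List.ext_getElem hlen
    intro i h₁ h₂
    have h₃ := congrFun h i
    rw [wcat_of_lt (by simp; omega), wcat_of_lt (by simp; omega),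
      List.getElem_append_left h₁, List.getElem_append_left h₂] at h₃
    exact h₃
  · funext i
    have h₃ := congrFun h ((u ++ [Sig4.amp]).length + i)
    rw [wcat_add, show (u ++ [Sig4.amp]).length = (u' ++ [Sig4.amp]).length by simp [hlen],
      wcat_add] at h₃
    exact h₃

/-- Two runs meeting after reading `x` and `x'` can be spliced there. -/
theorem NBA.wcat_mem_lang_of_eq {A S : Type} {M : NBA A S} {x x' : List A} {y y' : ℕ → A}
    {r r' : ℕ → S} (hr : M.IsRun (wcat x y) r) (hr' : M.IsRun (wcat x' y') r')
    (hacc : ∀ m : ℕ, ∃ n, m ≤ n ∧ r' n ∈ M.acc) (h : r x.length = r' x'.length) :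
    wcat x y' ∈ M.Lang := by
  have hle : ∀ i, (if i < x.length then r i else r' (x'.length + (i - x.length))) =
      if i ≤ x.length then r i else r' (x'.length + (i - x.length)) := by
    intro i
    rcases lt_trichotomy i x.length with hi | rfl | hi
    · simp [hi, hi.le]
    · simp [h]
    · simp [hi.not_gt, hi.not_ge]
  refine ⟨fun i => if i < x.length then r i else r' (x'.length + (i - x.length)),
    ⟨?_, fun i => ?_⟩, fun m => ?_⟩
  · simp only [hle]
    simpa using hr.1
  · by_cases hi : i < x.length
    · have := hr.2 i
      rw [wcat_of_lt hi] at this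
      simp only [hle (i + 1), hi, if_true, Nat.succ_le_of_lt hi, wcat_of_lt hi]
      exact this
    · obtain ⟨j, rfl⟩ := Nat.exists_eq_add_of_le (not_lt.mp hi)
      have := hr'.2 (x'.length + j)
      rw [wcat_add] at this
      simpa [wcat_add, add_assoc] using this
  · obtain ⟨k, hk, hk'⟩ := hacc (x'.length + m)
    refine ⟨x.length + (k - x'.length), by omega, ?_⟩
    simpa [show x'.length + (k - x'.length) = k by omega] using hk'

/-- A concatenation of blocks, then `&`, then another one padded by `#`, belongs to `Ln n` exactly
when the length-`n` blocks of the second are among those of the first. -/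
theorem wcat_flatMap_blk_mem_Ln_iff {n : ℕ} (hn : 1 ≤ n) (l l' : List (List Bool)) :
    wcat (l.flatMap blk ++ [Sig4.amp]) (wcat (l'.flatMap blk) fun _ => Sig4.hash) ∈ Ln n ↔
      ∀ w ∈ l', w.length = n → w ∈ l := by
  have hne : ∀ w : List Bool, w.length = n → w ≠ [] := by
    rintro w hw rfl
    simp at hw
    omega
  constructor
  · rintro ⟨u, v, hu, -, heq, hocc⟩ w hw hwn
    obtain ⟨rfl, rfl⟩ := wcat_amp_inj (noAmpL_flatMap_blk l) hu heq
    exact mem_of_blk_isInfix (hne w hwn) (k := 0)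
      (by simpa using hocc w hwn (occursInW_wcat_of_isInfix _ (blk_isInfix_flatMap hw)))
  · intro h
    exact ⟨_, _, noAmpL_flatMap_blk l,
      (noAmpL_flatMap_blk l').noAmpW_wcat (fun _ => by simp), rfl,
      fun w hw hocc => blk_isInfix_flatMap (h w (mem_of_occursInW (hne w hw) hocc) hw)⟩

/-- For every n ≥ 1, every nondeterministic Büchi automaton over
the alphabet {0,1,#,&} recognizing the disjoint union `L_n ⊎ {0,1,#}^ω` has at
least `2^(2^n)` states. -/
theorem Ln_union_nba_lower_bound (n : ℕ) (hn : 1 ≤ n)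
    (S : Type) (inst : Fintype S) (M : NBA Sig4 S)
    (hL : M.Lang = Ln n ∪ { v : ℕ → Sig4 | NoAmpW v }) :
    2 ^ 2 ^ n ≤ @Fintype.card S inst := by
  let e : Finset (List.Vector Bool n) → List (List Bool) := fun B => B.toList.map (·.toList)
  let x : Finset (List.Vector Bool n) → List Sig4 := fun B => (e B).flatMap blk ++ [Sig4.amp]
  let y : Finset (List.Vector Bool n) → ℕ → Sig4 :=
    fun B => wcat ((e B).flatMap blk) fun _ => Sig4.hash
  have hmem : ∀ B, wcat (x B) (y B) ∈ M.Lang := fun B => by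
    rw [hL]
    exact Or.inl ((wcat_flatMap_blk_mem_Ln_iff hn _ _).mpr fun w hw _ => hw)
  choose r hr hacc using hmem
  have hsub : ∀ B C, r B (x B).length = r C (x C).length → C ⊆ B := by
    intro B C h w hw
    have hBC := NBA.wcat_mem_lang_of_eq (hr B) (hr C) (hacc C) h
    rw [hL] at hBC
    rcases hBC with hBC | hBC
    · have := (wcat_flatMap_blk_mem_Ln_iff hn _ _).mp hBC w.toList
        (List.mem_map_of_mem (Finset.mem_toList.mpr hw)) w.toList_length
      obtain ⟨w', hw', heq⟩ := List.mem_map.mp this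
      rwa [← List.Vector.eq _ _ heq, ← Finset.mem_toList]
    · exact absurd (wcat_append_singleton_length _ _ _) (hBC ((e B).flatMap blk).length)
  have hinj : Function.Injective fun B => r B (x B).length := fun B C h =>
    (hsub C B h.symm).antisymm (hsub B C h)
  have hcard := Fintype.card_le_of_injective _ hinj
  simpa using hcard
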